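/- Let A be a special G-Frobenius algebra with cocycle γ defined by 1_g ∘ 1_h = γ_{g,h} ∘ 1_{gh}, and let I_g ⊆ A_e denote the annihilator of 1_g. Then: (1) for every g ∈ G and every a ∈ I_g, η(γ_{g,g⁻¹} ∘ a, 1) = 0; (2) if g, h ∈ G satisfy γ_{g,h} = 1 and γ_{h⁻¹,g⁻¹} = 1 (the unit of A_e), then γ_{gh,(gh)⁻¹} = γ_{g,g⁻¹} ∘ γ_{h,h⁻¹}. -/

import Mathlib

/-- A `G`-twisted Frobenius algebra (G-Frobenius algebra) over a field `k`. -/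
structure GFrobenius (k G A : Type*)
    [Field k] [Group G] [DecidableEq G] [AddCommGroup A] [Module k A] where
  grade : G → Submodule k A
  internal : DirectSum.IsInternal grade
  finite : FiniteDimensional k A
  mul : A →ₗ[k] A →ₗ[k] A
  one : A
  eta : A →ₗ[k] A →ₗ[k] k
  phi : G → A →ₗ[k] A
  chi : G → k
  one_mem : one ∈ grade 1
  mul_mem : ∀ g h : G, ∀ a ∈ grade g, ∀ b ∈ grade h, mul a b ∈ grade (g * h)
  mul_assoc' : ∀ a b c : A, mul (mul a b) c = mul a (mul b c)
  twisted_comm : ∀ g h : G, ∀ a ∈ grade g, ∀ b ∈ grade h, mul a b = mul (phi g b) a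
  one_mul' : ∀ a : A, mul one a = a
  mul_one' : ∀ a : A, mul a one = a
  phi_id : phi 1 = LinearMap.id
  phi_comp : ∀ g h : G, phi (g * h) = (phi g).comp (phi h)
  phi_fixes_one : ∀ g : G, phi g one = one
  eta_nondeg_left : ∀ a : A, (∀ b : A, eta a b = 0) → a = 0
  eta_nondeg_right : ∀ b : A, (∀ a : A, eta a b = 0) → b = 0
  eta_grade : ∀ g h : G, g * h ≠ 1 → ∀ a ∈ grade g, ∀ b ∈ grade h, eta a b = 0
  eta_invariant : ∀ a b c : A, eta a (mul b c) = eta (mul a b) c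
  chi_one : chi 1 = 1
  chi_mul : ∀ g h : G, chi (g * h) = chi g * chi h
  chi_ne : ∀ g : G, chi g ≠ 0
  phi_grade : ∀ g h : G, ∀ a ∈ grade h, phi g a ∈ grade (g * h * g⁻¹)
  phi_self : ∀ g : G, ∀ a ∈ grade g, phi g a = (chi g)⁻¹ • a
  phi_mul : ∀ (g : G) (a b : A), phi g (mul a b) = mul (phi g a) (phi g b)
  phi_eta : ∀ (g : G) (a b : A), eta (phi g a) (phi g b) = ((chi g) ^ 2)⁻¹ * eta a b
  trace_axiom : ∀ g h : G, ∀ c ∈ grade (g * h * g⁻¹ * h⁻¹),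
    ∀ (hf : ∀ x ∈ grade g, ((mul c).comp (phi h)) x ∈ grade g)
      (hg : ∀ x ∈ grade h, ((phi g⁻¹).comp (mul c)) x ∈ grade h),
      chi h * LinearMap.trace k ↥(grade g) (((mul c).comp (phi h)).restrict hf)
        = chi g⁻¹ * LinearMap.trace k ↥(grade h) (((phi g⁻¹).comp (mul c)).restrict hg)

/-- A special `G`-Frobenius algebra: all twisted sectors are cyclic `A_e`-modules
with chosen generators `1_g` and sections `i_g`. -/
structure SpecialGFrobenius (k G A : Type*)
    [Field k] [Group G] [DecidableEq G] [AddCommGroup A] [Module k A]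
    extends GFrobenius k G A where
  oneg : G → A
  oneg_mem : ∀ g : G, oneg g ∈ grade g
  oneg_one : oneg 1 = one
  oneg_ne : ∀ g : G, oneg g ≠ 0
  iota : G → A →ₗ[k] A
  iota_mem : ∀ g : G, ∀ x ∈ grade g, iota g x ∈ grade 1
  iota_section : ∀ g : G, ∀ x ∈ grade g, mul (iota g x) (oneg g) = x
  iota_module : ∀ g : G, ∀ a ∈ grade 1, ∀ b ∈ grade g,
      iota g (mul a b) = mul (iota g (mul a (oneg g))) (iota g b)
  phiScalar : G → G → k
  phi_oneg : ∀ g h : G, phi g (oneg h) = phiScalar g h • oneg (g * h * g⁻¹)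
  phiScalar_one : ∀ g : G, phiScalar g 1 = 1

namespace SpecialGFrobenius

variable {k G A : Type*} [Field k] [Group G] [DecidableEq G] [AddCommGroup A] [Module k A]

/-- The restriction map `r_g : a ↦ a ∘ 1_g`. -/
def r (S : SpecialGFrobenius k G A) (g : G) : A →ₗ[k] A := S.mul.flip (S.oneg g)

/-- The projection `π_g = i_g ∘ r_g`. -/
def proj (S : SpecialGFrobenius k G A) (g : G) : A →ₗ[k] A := (S.iota g).comp (S.r g)

/-- The cocycle `γ_{g,h} = i_{gh}(1_g ∘ 1_h)`. -/
def gam (S : SpecialGFrobenius k G A) (g h : G) : A :=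
  S.iota (g * h) (S.mul (S.oneg g) (S.oneg h))

/-- The image `i_g(A_g) ⊆ A_e`. -/
def Bsub (S : SpecialGFrobenius k G A) (g : G) : Submodule k A :=
  (S.grade g).map (S.iota g)

end SpecialGFrobenius

namespace SpecialGFrobenius

variable {k G A : Type*} [Field k] [Group G] [DecidableEq G] [AddCommGroup A] [Module k A]

/-- Elements of the untwisted sector `A_e` commute with homogeneous elements. -/
theorem mul_comm_of_mem_grade_one (S : SpecialGFrobenius k G A) {a b : A} {h : G}
    (ha : a ∈ S.grade 1) (hb : b ∈ S.grade h) : S.mul a b = S.mul b a := by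
  rw [S.twisted_comm 1 h a ha b hb, S.phi_id, LinearMap.id_apply]

/-- The cocycle satisfies `γ_{g,h} ∘ 1_{gh} = 1_g ∘ 1_h`. -/
theorem gam_mul_oneg (S : SpecialGFrobenius k G A) (g h : G) :
    S.mul (S.gam g h) (S.oneg (g * h)) = S.mul (S.oneg g) (S.oneg h) :=
  S.iota_section _ _ (S.mul_mem _ _ _ (S.oneg_mem g) _ (S.oneg_mem h))

theorem gam_inv_right (S : SpecialGFrobenius k G A) (g : G) :
    S.gam g g⁻¹ = S.mul (S.oneg g) (S.oneg g⁻¹) := by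
  rw [← S.gam_mul_oneg, mul_inv_cancel, S.oneg_one, S.mul_one']

theorem gam_mem_grade_one (S : SpecialGFrobenius k G A) (g h : G) :
    S.gam g h ∈ S.grade 1 :=
  S.iota_mem _ _ (S.mul_mem _ _ _ (S.oneg_mem g) _ (S.oneg_mem h))

theorem oneg_mul_of_gam_eq_one (S : SpecialGFrobenius k G A) {g h : G}
    (hgh : S.gam g h = S.one) : S.oneg (g * h) = S.mul (S.oneg g) (S.oneg h) := by
  rw [← S.gam_mul_oneg, hgh, S.one_mul']

end SpecialGFrobenius

/-- in a special `G`-Frobenius algebra: (1) `η(γ_{g,g⁻¹} ∘ a, 1) = 0` for every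
`a ∈ I_g = Ann_{A_e}(1_g)`; (2) if `γ_{g,h} = 1` and `γ_{h⁻¹,g⁻¹} = 1` then
`γ_{gh,(gh)⁻¹} = γ_{g,g⁻¹} ∘ γ_{h,h⁻¹}`. -/
theorem gamma_diag_properties
    {k G A : Type*} [Field k] [CharZero k] [Group G] [DecidableEq G] [Fintype G]
    [AddCommGroup A] [Module k A] (S : SpecialGFrobenius k G A) :
    (∀ g : G, ∀ a ∈ S.grade 1, S.mul a (S.oneg g) = 0 →
        S.eta (S.mul (S.gam g g⁻¹) a) S.one = 0) ∧
    (∀ g h : G, S.gam g h = S.one → S.gam h⁻¹ g⁻¹ = S.one →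
        S.gam (g * h) (g * h)⁻¹ = S.mul (S.gam g g⁻¹) (S.gam h h⁻¹)) := by
  refine ⟨fun g a ha h => ?_, fun g h hgh hinv => ?_⟩
  · rw [← S.mul_comm_of_mem_grade_one ha (S.gam_mem_grade_one g g⁻¹), S.gam_inv_right,
      ← S.mul_assoc', h]
    simp
  · rw [S.gam_inv_right (g * h), mul_inv_rev, S.oneg_mul_of_gam_eq_one hgh,
      S.oneg_mul_of_gam_eq_one hinv, S.mul_assoc', ← S.mul_assoc' (S.oneg h), ← S.gam_inv_right h,
      S.mul_comm_of_mem_grade_one (S.gam_mem_grade_one h h⁻¹) (S.oneg_mem g⁻¹),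
      ← S.mul_assoc', ← S.gam_inv_right g]
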